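/- Let μ be a finitely supported distribution over RCCS^ω processes, L ⊆ N a finite set of channels containing all channels occurring in μ, and a ∈ N ∖ L a fresh channel. Then χmay_ω(μ) = χmay_𝓛((L)(μ[ω↦a])) and χfair_ω(μ) = χfair_𝓛((L)(μ[ω↦a])), where μ[ω↦a] renames the success action ω to the channel a pointwise. -/

import Mathlib

open scoped Classical

/-! ## Channels, actions, RCCS terms -/

/-- Channels, drawn from an infinite set. -/
abbrev Chan := ℕ

/-- Actions: input/output labels over channels, the silent action `τ`, and the
distinguished success action `ω` (used only by observers). -/
inductive Act where
  | inp : Chan → Act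
  | out : Chan → Act
  | tau : Act
  | omega : Act
deriving DecidableEq

/-- `α` is an external label, i.e. a member of `𝓛 = N ∪ N̄`. -/
def Act.IsLabel : Act → Prop
  | .inp _ => True
  | .out _ => True
  | _ => False

/-- Complementary labels (for communication). -/
def Act.Comp : Act → Act → Prop := fun x y =>
  ∃ a, (x = .inp a ∧ y = .out a) ∨ (x = .out a ∧ y = .inp a)

/-- `β, β̄ ∉ L`: the action is not blocked by the localization `(L)-`. -/
def Act.Allowed (L : Finset Chan) : Act → Prop
  | .inp a => a ∉ L
  | .out a => a ∉ L
  | _ => True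

/-- Channels occurring in an action. -/
def Act.chans : Act → Finset Chan
  | .inp a => {a}
  | .out a => {a}
  | _ => ∅

/-- RCCS (and RCCS^ω) terms, with de Bruijn indices for process variables.
`sum k acts conts` is the nondeterministic choice `Σ_{i∈I} α_i.T_i` over the
nonempty finite index set `I = Fin (k+1)`, and `oplus k w conts` is the
probabilistic choice `⊕_{i∈I} p_i τ.T_i`. `fix T` is `μX.T` (binding index 0). -/
inductive Tm where
  | nil : Tm
  | var : ℕ → Tm
  | sum : (k : ℕ) → (Fin (k+1) → Act) → (Fin (k+1) → Tm) → Tm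
  | oplus : (k : ℕ) → (Fin (k+1) → ℝ) → (Fin (k+1) → Tm) → Tm
  | par : Tm → Tm → Tm
  | loc : Finset Chan → Tm → Tm
  | fix : Tm → Tm

/-- Substitution `T{P/X}` of a (closed) term `P` for the de Bruijn variable `n`. -/
def Tm.subst (P : Tm) : ℕ → Tm → Tm
  | _, .nil => .nil
  | n, .var m => if m = n then P else .var m
  | n, .sum k a c => .sum k a (fun i => Tm.subst P n (c i))
  | n, .oplus k w c => .oplus k w (fun i => Tm.subst P n (c i))
  | n, .par S T => .par (Tm.subst P n S) (Tm.subst P n T)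
  | n, .loc L T => .loc L (Tm.subst P n T)
  | n, .fix T => .fix (Tm.subst P (n+1) T)

/-- `T` has all its free variables among the first `n` de Bruijn indices.
`ClosedAt 0 T` means `T` is closed; `ClosedAt 1 T` means at most one free variable. -/
def Tm.ClosedAt : ℕ → Tm → Prop
  | _, .nil => True
  | n, .var m => m < n
  | n, .sum _ _ c => ∀ i, Tm.ClosedAt n (c i)
  | n, .oplus _ _ c => ∀ i, Tm.ClosedAt n (c i)
  | n, .par S T => Tm.ClosedAt n S ∧ Tm.ClosedAt n T
  | n, .loc _ T => Tm.ClosedAt n T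
  | n, .fix T => Tm.ClosedAt (n+1) T

/-- The success action `ω` does not occur in `T` (so `T` is a genuine RCCS term). -/
def Tm.NoOmega : Tm → Prop
  | .nil => True
  | .var _ => True
  | .sum _ a c => (∀ i, a i ≠ Act.omega) ∧ (∀ i, Tm.NoOmega (c i))
  | .oplus _ _ c => ∀ i, Tm.NoOmega (c i)
  | .par S T => Tm.NoOmega S ∧ Tm.NoOmega T
  | .loc _ T => Tm.NoOmega T
  | .fix T => Tm.NoOmega T

/-- No probabilistic choice occurs in `T` (so `T` is a CCS term). -/
def Tm.NoOplus : Tm → Prop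
  | .nil => True
  | .var _ => True
  | .sum _ _ c => ∀ i, Tm.NoOplus (c i)
  | .oplus _ _ _ => False
  | .par S T => Tm.NoOplus S ∧ Tm.NoOplus T
  | .loc _ T => Tm.NoOplus T
  | .fix T => Tm.NoOplus T

/-- The channels `N(T)` occurring in a term. -/
def Tm.chans : Tm → Finset Chan
  | .nil => ∅
  | .var _ => ∅
  | .sum _ a c =>
      (Finset.univ.sup fun i => (a i).chans) ∪ (Finset.univ.sup fun i => Tm.chans (c i))
  | .oplus _ _ c => Finset.univ.sup fun i => Tm.chans (c i)
  | .par S T => S.chans ∪ T.chans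
  | .loc L T => L ∪ T.chans
  | .fix T => T.chans

/-- Renaming of channels in an action. -/
def Act.rename (f : Chan → Chan) : Act → Act
  | .inp a => .inp (f a)
  | .out a => .out (f a)
  | x => x

/-- Renaming `T[f]` of the global channels of a term (local channels are untouched). -/
def Tm.rename : (Chan → Chan) → Tm → Tm
  | _, .nil => .nil
  | _, .var m => .var m
  | f, .sum k a c => .sum k (fun i => (a i).rename f) (fun i => Tm.rename f (c i))
  | f, .oplus k w c => .oplus k w (fun i => Tm.rename f (c i))
  | f, .par S T => .par (Tm.rename f S) (Tm.rename f T)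
  | f, .loc L T => .loc L (Tm.rename (fun a => if a ∈ L then a else f a) T)
  | f, .fix T => .fix (Tm.rename f T)

/-- `P` is an RCCS process: closed and without the success action. -/
def Tm.IsProc (P : Tm) : Prop := Tm.ClosedAt 0 P ∧ Tm.NoOmega P

/-- `P` is a CCS process: a process without probabilistic choice. -/
def Tm.IsCCS (P : Tm) : Prop := P.IsProc ∧ Tm.NoOplus P

/-! ## Finitely supported distributions -/

/-- Finitely supported probability distributions on `α`. -/
structure FinDist (α : Type) where
  toFun : α → ℝ
  nonneg : ∀ a, 0 ≤ toFun a
  finite_support : (Function.support toFun).Finite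
  sum_one : ∑ᶠ a, toFun a = 1

namespace FinDist

/-- The probability `μ(φ)` that a predicate (set) `φ` holds under `μ`. -/
noncomputable def mass {α : Type} (μ : FinDist α) (φ : Set α) : ℝ :=
  ∑ᶠ a ∈ φ, μ.toFun a

/-- The Dirac distribution `δ_P`. -/
noncomputable def dirac {α : Type} (P : α) : FinDist α where
  toFun := fun Q => if Q = P then 1 else 0
  nonneg := by intro a; by_cases h : a = P <;> simp [h]
  finite_support := by
    apply Set.Finite.subset (Set.finite_singleton P)
    intro a ha
    by_contra h
    simp only [Set.mem_singleton_iff] at h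
    simp [Function.mem_support, h] at ha
  sum_one := by
    rw [finsum_eq_single _ P (fun b hb => by simp [hb])]
    simp

/-- Pushforward of a finitely supported distribution along a map. -/
noncomputable def map {α β : Type} (g : α → β) (μ : FinDist α) : FinDist β where
  toFun := fun b => ∑ᶠ a ∈ {a | g a = b}, μ.toFun a
  nonneg := by
    intro b
    exact finsum_nonneg fun a => finsum_nonneg fun _ => μ.nonneg a
  finite_support := by
    apply Set.Finite.subset (μ.finite_support.image g)
    intro b hb
    rw [Function.mem_support] at hb
    by_contra h
    apply hb
    apply finsum_mem_eq_zero_of_forall_eq_zero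
    intro a ha
    by_contra ha0
    exact h ⟨a, Function.mem_support.mpr ha0, ha⟩
  sum_one := by
    classical
    set s := μ.finite_support.toFinset with hs
    have hfib : ∀ b : β, (∑ᶠ a ∈ {a | g a = b}, μ.toFun a)
        = ∑ a ∈ s.filter (fun a => g a = b), μ.toFun a := by
      intro b
      apply finsum_mem_eq_sum_of_inter_support_eq
      ext a
      simp only [Set.mem_inter_iff, Set.mem_setOf_eq, Finset.coe_filter,
        Set.Finite.mem_toFinset, Function.mem_support, hs]
      tauto
    have hsub : Function.support (fun b : β => ∑ᶠ a ∈ {a | g a = b}, μ.toFun a) ⊆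
        ↑(s.image g) := by
      intro b hb
      rw [Function.mem_support, hfib] at hb
      obtain ⟨a, ha, hne⟩ := Finset.exists_ne_zero_of_sum_ne_zero hb
      rw [Finset.mem_filter] at ha
      simp only [Finset.coe_image, Set.mem_image, Finset.mem_coe]
      exact ⟨a, ha.1, ha.2⟩
    rw [finsum_eq_finset_sum_of_support_subset _ hsub]
    calc ∑ b ∈ s.image g, ∑ᶠ a ∈ {a | g a = b}, μ.toFun a
        = ∑ b ∈ s.image g, ∑ a ∈ s.filter (fun a => g a = b), μ.toFun a :=
          Finset.sum_congr rfl fun b _ => hfib b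
      _ = ∑ a ∈ s, μ.toFun a :=
          Finset.sum_fiberwise_of_maps_to (fun a ha => Finset.mem_image_of_mem g ha)
            μ.toFun
      _ = 1 := by rw [← finsum_eq_sum μ.toFun μ.finite_support]; exact μ.sum_one

/-- The product of two finitely supported distributions. -/
noncomputable def prod {α β : Type} (μ : FinDist α) (ν : FinDist β) :
    FinDist (α × β) where
  toFun := fun x => μ.toFun x.1 * ν.toFun x.2
  nonneg := fun x => mul_nonneg (μ.nonneg _) (ν.nonneg _)
  finite_support := by
    apply Set.Finite.subset (μ.finite_support.prod ν.finite_support)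
    intro x hx
    rw [Function.mem_support] at hx
    have h := mul_ne_zero_iff.mp hx
    exact ⟨Function.mem_support.mpr h.1, Function.mem_support.mpr h.2⟩
  sum_one := by
    classical
    have hsub : Function.support (fun x : α × β => μ.toFun x.1 * ν.toFun x.2) ⊆
        ↑(μ.finite_support.toFinset ×ˢ ν.finite_support.toFinset) := by
      intro x hx
      rw [Function.mem_support] at hx
      have h := mul_ne_zero_iff.mp hx
      simp only [Finset.coe_product, Set.mem_prod, Set.Finite.coe_toFinset]
      exact ⟨h.1, h.2⟩
    rw [finsum_eq_finset_sum_of_support_subset _ hsub, Finset.sum_product]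
    have h1 : ∑ a ∈ μ.finite_support.toFinset, μ.toFun a = 1 := by
      rw [← finsum_eq_sum μ.toFun μ.finite_support]; exact μ.sum_one
    have h2 : ∑ b ∈ ν.finite_support.toFinset, ν.toFun b = 1 := by
      rw [← finsum_eq_sum ν.toFun ν.finite_support]; exact ν.sum_one
    calc ∑ a ∈ μ.finite_support.toFinset, ∑ b ∈ ν.finite_support.toFinset,
          μ.toFun a * ν.toFun b
        = ∑ a ∈ μ.finite_support.toFinset, μ.toFun a * 1 := by
          refine Finset.sum_congr rfl fun a _ => ?_
          rw [← Finset.mul_sum, h2]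
      _ = 1 := by simpa using h1

/-- Parallel composition `μ | ν` of distributions:
`(μ|ν)(A|B) = μ(A)·ν(B)`. -/
noncomputable def parD (μ ν : FinDist Tm) : FinDist Tm :=
  (μ.prod ν).map fun x => Tm.par x.1 x.2

/-- Localization `(L)μ` of a distribution. -/
noncomputable def locD (L : Finset Chan) (μ : FinDist Tm) : FinDist Tm :=
  μ.map (Tm.loc L)

/-- Renaming `μ[f]` of a distribution. -/
noncomputable def renameD (f : Chan → Chan) (μ : FinDist Tm) : FinDist Tm :=
  μ.map (Tm.rename f)

/-- Instantiation `ϑ[P]` of a 1-ary distribution `ϑ` at the process `P`. -/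
noncomputable def instD (ϑ : FinDist Tm) (P : Tm) : FinDist Tm :=
  ϑ.map (fun T => Tm.subst P 0 T)

/-- Every element of the support is a process (`μ ∈ D(P_RCCS)`). -/
def IsProcDist (μ : FinDist Tm) : Prop := ∀ P, μ.toFun P ≠ 0 → P.IsProc

/-- All channels occurring in (the support of) `μ` lie in `L`. -/
def chansIn (μ : FinDist Tm) (L : Finset Chan) : Prop :=
  ∀ P, μ.toFun P ≠ 0 → P.chans ⊆ L

/-- The channel `a` occurs in (the support of) `μ`, i.e. `a ∈ N(μ)`. -/
def hasChan (μ : FinDist Tm) (a : Chan) : Prop := ∃ P, μ.toFun P ≠ 0 ∧ a ∈ P.chans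

end FinDist

/-! ## Part I: the probabilistic labelled transition system on processes -/

/-- Part I of the pLTS for RCCS (and RCCS^ω): `P →α ρ`. -/
inductive Step : Tm → Act → FinDist Tm → Prop where
  | choice {k : ℕ} (acts : Fin (k+1) → Act) (conts : Fin (k+1) → Tm) (i : Fin (k+1)) :
      Step (.sum k acts conts) (acts i) (FinDist.dirac (conts i))
  | oplus {k : ℕ} (w : Fin (k+1) → ℝ) (conts : Fin (k+1) → Tm) (ρ : FinDist Tm) :
      (∀ i, 0 < w i ∧ w i < 1) →
      (∀ Q, ρ.toFun Q = ∑ i, if conts i = Q then w i else 0) →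
      Step (.oplus k w conts) .tau ρ
  | parL {S : Tm} {α : Act} {ρ : FinDist Tm} (T : Tm) :
      Step S α ρ → Step (.par S T) α (ρ.parD (FinDist.dirac T))
  | parR {T : Tm} {α : Act} {ρ : FinDist Tm} (S : Tm) :
      Step T α ρ → Step (.par S T) α ((FinDist.dirac S).parD ρ)
  | comm {S T : Tm} {ℓ1 ℓ2 : Act} {ρ1 ρ2 : FinDist Tm} :
      Act.Comp ℓ1 ℓ2 → Step S ℓ1 ρ1 → Step T ℓ2 ρ2 →
      Step (.par S T) .tau (ρ1.parD ρ2)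
  | loc {T : Tm} {β : Act} {ρ : FinDist Tm} (L : Finset Chan) :
      Step T β ρ → Act.Allowed L β → Step (.loc L T) β (FinDist.locD L ρ)
  | fixp {T : Tm} {β : Act} {ρ : FinDist Tm} :
      Step (Tm.subst (.fix T) 0 T) β ρ → Step (.fix T) β ρ

/-! ## Part II: probabilistic transitions on distributions -/

/-- Part II of the pLTS: `μ →(α,p) ν` iff `0 < p ≤ 1` and there are `P ∈ supp μ`
and `ρ` with `P →α ρ` and `ν = μ + μ(P)·p·(ρ − δ_P)`. -/
def PStep (μ : FinDist Tm) (α : Act) (p : ℝ) (ν : FinDist Tm) : Prop :=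
  0 < p ∧ p ≤ 1 ∧
    ∃ P ρ, 0 < μ.toFun P ∧ Step P α ρ ∧
      ∀ Q, ν.toFun Q = μ.toFun Q + μ.toFun P * p * (ρ.toFun Q - (if Q = P then 1 else 0))

/-- Probabilistic transition sequence `μ →π ν` along a word `π`. -/
def PSeq : FinDist Tm → List (Act × ℝ) → FinDist Tm → Prop
  | μ, [], ν => ν = μ
  | μ, s :: π, ν => ∃ μ', PStep μ s.1 s.2 μ' ∧ PSeq μ' π ν

/-- Internal transition sequence `μ ⇝ ν`. -/
def Internal (μ ν : FinDist Tm) : Prop :=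
  ∃ π : List (Act × ℝ), (∀ s ∈ π, s.1 = Act.tau) ∧ PSeq μ π ν

/-! ## Observability predicates and testing characteristics -/

/-- `ψ_𝓛`: processes that can immediately perform an external action. -/
def psiL : Set Tm := {P | ∃ α ρ, Act.IsLabel α ∧ Step P α ρ}

/-- `ψ_ω`: processes that can immediately perform the success action `ω`. -/
def psiOmega : Set Tm := {P | ∃ ρ, Step P Act.omega ρ}

/-- The may characteristic `χmay_𝓛(μ) = sup { ν(ψ_𝓛) : μ ⇝ ν }`. -/
noncomputable def chiMayL (μ : FinDist Tm) : ℝ :=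
  sSup {x | ∃ ν, Internal μ ν ∧ x = ν.mass psiL}

/-- The fair characteristic `χfair_𝓛(μ) = inf { χmay_𝓛(ν) : μ ⇝ ν }`. -/
noncomputable def chiFairL (μ : FinDist Tm) : ℝ :=
  sInf {x | ∃ ν, Internal μ ν ∧ x = chiMayL ν}

/-- `χmay_ω(μ) = sup { ν(ψ_ω) : μ ⇝ ν }`. -/
noncomputable def chiMayOmega (μ : FinDist Tm) : ℝ :=
  sSup {x | ∃ ν, Internal μ ν ∧ x = ν.mass psiOmega}

/-- `χfair_ω(μ) = inf { χmay_ω(ν) : μ ⇝ ν }`. -/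
noncomputable def chiFairOmega (μ : FinDist Tm) : ℝ :=
  sInf {x | ∃ ν, Internal μ ν ∧ x = chiMayOmega ν}

/-! ## Testing contexts, equipollence, extensionality, diamond/box equivalences -/

/-- `Δ(P_CCS) ⊆ 𝒟 ⊆ D(P_RCCS)`, closed under parallel composition, localization
and (finite-domain) renaming. -/
structure IsTestingContext (D : Set (FinDist Tm)) : Prop where
  dirac_ccs : ∀ P : Tm, P.IsCCS → FinDist.dirac P ∈ D
  proc_dist : ∀ μ ∈ D, μ.IsProcDist
  closed_par : ∀ μ ∈ D, ∀ ν ∈ D, μ.parD ν ∈ D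
  closed_loc : ∀ μ ∈ D, ∀ L : Finset Chan, FinDist.locD L μ ∈ D
  closed_rename : ∀ μ ∈ D, ∀ f : Chan → Chan, {a | f a ≠ a}.Finite →
      FinDist.renameD f μ ∈ D

/-- `R` is probabilistically equipollent. -/
def Equipollent (R : FinDist Tm → FinDist Tm → Prop) : Prop :=
  ∀ μ1 μ2, R μ1 μ2 → chiMayL μ1 = chiMayL μ2

/-- `R` is probabilistically strongly equipollent. -/
def StronglyEquipollent (R : FinDist Tm → FinDist Tm → Prop) : Prop :=
  ∀ μ1 μ2, R μ1 μ2 → chiFairL μ1 = chiFairL μ2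

/-- `R` is `𝒟`-extensional. -/
def DExtensional (D : Set (FinDist Tm)) (R : FinDist Tm → FinDist Tm → Prop) : Prop :=
  ∀ μ1 μ2, R μ1 μ2 →
    (∀ ν ∈ D, R (μ1.parD ν) (μ2.parD ν)) ∧
    (∀ L : Finset Chan, R (FinDist.locD L μ1) (FinDist.locD L μ2))

/-- The `𝒟`-diamond equivalence `=◇^𝒟`, the largest probabilistically equipollent
`𝒟`-extensional relation. -/
def DiamondEq (D : Set (FinDist Tm)) (μ1 μ2 : FinDist Tm) : Prop :=
  ∃ R, Equipollent R ∧ DExtensional D R ∧ R μ1 μ2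

/-- The `𝒟`-box equivalence `=□^𝒟`, the largest probabilistically strongly
equipollent `𝒟`-extensional relation. -/
def BoxEq (D : Set (FinDist Tm)) (μ1 μ2 : FinDist Tm) : Prop :=
  ∃ R, StronglyEquipollent R ∧ DExtensional D R ∧ R μ1 μ2

/-! ## Probabilistic strong bisimulation and lifting -/

/-- Lifting of a relation on processes to distributions, matching the decomposition
`ρ1 = Σ_i p_i δ_{A_i}`, `ρ2 = Σ_i p_i δ_{B_i}` with `A_i R B_i`. -/
def RelLift (R : Tm → Tm → Prop) (ρ1 ρ2 : FinDist Tm) : Prop :=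
  ∃ (k : ℕ) (p : Fin (k+1) → ℝ) (A B : Fin (k+1) → Tm),
    (∀ i, 0 ≤ p i) ∧
    (∀ Q, ρ1.toFun Q = ∑ i, if A i = Q then p i else 0) ∧
    (∀ Q, ρ2.toFun Q = ∑ i, if B i = Q then p i else 0) ∧
    (∀ i, R (A i) (B i))

/-- `R` is a probabilistic strong bisimulation. -/
def IsStrongBisim (R : Tm → Tm → Prop) : Prop :=
  ∀ P Q, R P Q →
    (∀ α ρ, Step P α ρ → ∃ ρ', Step Q α ρ' ∧ RelLift R ρ ρ') ∧
    (∀ α ρ, Step Q α ρ → ∃ ρ', Step P α ρ' ∧ RelLift R ρ ρ')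

/-- `∼p`, the largest probabilistic strong bisimulation. -/
def StrongBisim (P Q : Tm) : Prop := ∃ R, IsStrongBisim R ∧ R P Q

/-- Lifting `E†` of an equivalence on processes to distributions: agreement on the
mass of every equivalence class. -/
def EqLift (E : Tm → Tm → Prop) (μ1 μ2 : FinDist Tm) : Prop :=
  ∀ P, μ1.mass {Q | E P Q} = μ2.mass {Q | E P Q}

/-- Rename the success action `ω` to the channel `a`. -/
def Act.fromOmega (a : Chan) : Act → Act
  | .omega => .inp a
  | x => x

/-- Rename the success action `ω` to the channel `a` throughout a term. -/
def Tm.fromOmega (a : Chan) : Tm → Tm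
  | .nil => .nil
  | .var m => .var m
  | .sum k acts c => .sum k (fun i => (acts i).fromOmega a) (fun i => Tm.fromOmega a (c i))
  | .oplus k w c => .oplus k w (fun i => Tm.fromOmega a (c i))
  | .par S T => .par (Tm.fromOmega a S) (Tm.fromOmega a T)
  | .loc L T => .loc L (Tm.fromOmega a T)
  | .fix T => .fix (Tm.fromOmega a T)

/-- Pointwise renaming `μ[ω↦a]` of a distribution. -/
noncomputable def FinDist.fromOmegaD (a : Chan) (μ : FinDist Tm) : FinDist Tm :=
  μ.map (Tm.fromOmega a)

namespace FinDist

/-- Expectation of a real function. -/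
noncomputable def expect {α : Type} (μ : FinDist α) (f : α → ℝ) : ℝ :=
  ∑ x ∈ μ.finite_support.toFinset, μ.toFun x * f x

theorem ext_toFun {α : Type} {μ ν : FinDist α} (h : ∀ x, μ.toFun x = ν.toFun x) : μ = ν := by
  cases μ; cases ν
  congr
  exact funext h

theorem expect_eq {α : Type} (μ : FinDist α) (f : α → ℝ) (s : Finset α)
    (hs : ∀ x, μ.toFun x ≠ 0 → x ∈ s) : μ.expect f = ∑ x ∈ s, μ.toFun x * f x := by
  unfold expect
  apply Finset.sum_subset
  · intro x hx
    exact hs x (by simpa using hx)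
  · intro x _ hx
    have : μ.toFun x = 0 := by simpa using hx
    simp [this]

theorem expect_ind {α : Type} (μ : FinDist α) (b : α) :
    μ.expect (fun x => if x = b then 1 else 0) = μ.toFun b := by
  rw [expect_eq μ _ (insert b μ.finite_support.toFinset)
    (fun x hx => Finset.mem_insert_of_mem (by simpa using hx))]
  simp

theorem ext_expect {α : Type} {μ ν : FinDist α} (h : ∀ f, μ.expect f = ν.expect f) : μ = ν := by
  apply ext_toFun
  intro x
  rw [← expect_ind, ← expect_ind, h]

theorem expect_congr {α : Type} (μ : FinDist α) {f g : α → ℝ}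
    (h : ∀ x, μ.toFun x ≠ 0 → f x = g x) : μ.expect f = μ.expect g := by
  apply Finset.sum_congr rfl
  intro x hx
  rw [h x (by simpa using hx)]

theorem mass_eq {α : Type} (μ : FinDist α) (φ : Set α) :
    μ.mass φ = μ.expect (fun x => if x ∈ φ then 1 else 0) := by
  unfold mass expect
  rw [finsum_mem_eq_sum_of_inter_support_eq (t := μ.finite_support.toFinset.filter (· ∈ φ))]
  · rw [Finset.sum_filter]
    exact Finset.sum_congr rfl fun x _ => by by_cases hx : x ∈ φ <;> simp [hx]
  · ext x
    simp
    tauto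

theorem map_toFun {α β : Type} (g : α → β) (μ : FinDist α) (b : β) :
    (μ.map g).toFun b = μ.expect (fun x => if g x = b then 1 else 0) :=
  mass_eq μ {x | g x = b}

theorem map_support {α β : Type} {g : α → β} {μ : FinDist α} {b : β}
    (h : (μ.map g).toFun b ≠ 0) : ∃ x, μ.toFun x ≠ 0 ∧ g x = b := by
  rw [map_toFun] at h
  obtain ⟨x, hx, hne⟩ := Finset.exists_ne_zero_of_sum_ne_zero h
  refine ⟨x, by simpa using hx, ?_⟩
  by_contra hb
  simp [hb] at hne

theorem expect_map {α β : Type} (g : α → β) (μ : FinDist α) (f : β → ℝ) :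
    (μ.map g).expect f = μ.expect (fun x => f (g x)) := by
  rw [expect_eq _ f (μ.finite_support.toFinset.image g)]
  · simp only [map_toFun]
    unfold expect
    simp only [Finset.sum_mul]
    rw [Finset.sum_comm]
    apply Finset.sum_congr rfl
    intro x hx
    rw [Finset.sum_eq_single (g x)]
    · simp
    · intro b _ hb
      simp [hb.symm]
    · intro h
      exact absurd (Finset.mem_image_of_mem g hx) h
  · intro b hb
    obtain ⟨x, hx, rfl⟩ := map_support hb
    exact Finset.mem_image_of_mem g (by simpa using hx)

theorem expect_dirac {α : Type} (P : α) (f : α → ℝ) : (dirac P).expect f = f P := by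
  rw [expect_eq _ f {P}]
  · simp [dirac]
  · intro x hx
    by_contra h
    simp at h
    simp [dirac, h] at hx

theorem expect_prod {α β : Type} (μ : FinDist α) (ν : FinDist β) (f : α × β → ℝ) :
    (μ.prod ν).expect f = μ.expect (fun x => ν.expect (fun y => f (x, y))) := by
  rw [expect_eq _ f (μ.finite_support.toFinset ×ˢ ν.finite_support.toFinset)]
  · rw [Finset.sum_product]
    unfold expect
    simp only [Finset.mul_sum, prod, mul_assoc]
  · intro x hx
    have h := mul_ne_zero_iff.mp hx
    simpa using h

theorem expect_parD (μ ν : FinDist Tm) (f : Tm → ℝ) :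
    (μ.parD ν).expect f = μ.expect (fun x => ν.expect (fun y => f (.par x y))) := by
  unfold parD
  rw [expect_map, expect_prod]

theorem map_parD (F : Tm → Tm) (hF : ∀ S T, F (.par S T) = .par (F S) (F T))
    (μ ν : FinDist Tm) : (μ.parD ν).map F = (μ.map F).parD (ν.map F) := by
  apply ext_expect
  intro f
  simp only [expect_map, expect_parD, hF]

theorem map_dirac {α β : Type} (g : α → β) (P : α) : (dirac P).map g = dirac (g P) := by
  apply ext_expect
  intro f
  simp only [expect_map, expect_dirac]

theorem map_locD (F : Tm → Tm) (L : Finset Chan) (hF : ∀ T, F (.loc L T) = .loc L (F T))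
    (μ : FinDist Tm) : (locD L μ).map F = locD L (μ.map F) := by
  apply ext_expect
  intro f
  simp only [locD, expect_map, hF]

theorem dirac_support {α : Type} {P Q : α} (h : (dirac P).toFun Q ≠ 0) : Q = P := by
  by_contra h'
  simp [dirac, h'] at h

theorem parD_support {μ ν : FinDist Tm} {Q : Tm} (h : (μ.parD ν).toFun Q ≠ 0) :
    ∃ x y, μ.toFun x ≠ 0 ∧ ν.toFun y ≠ 0 ∧ Q = .par x y := by
  obtain ⟨⟨x, y⟩, hx, rfl⟩ := map_support h
  have h := mul_ne_zero_iff.mp hx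
  exact ⟨x, y, h.1, h.2, rfl⟩

theorem map_toFun_inj {α β : Type} (g : α → β) (μ : FinDist α) (P : α)
    (hinj : ∀ x, μ.toFun x ≠ 0 → g x = g P → x = P) :
    (μ.map g).toFun (g P) = μ.toFun P := by
  rw [map_toFun, ← expect_ind μ P]
  apply expect_congr
  intro x hx
  by_cases h : x = P
  · simp [h]
  · have : g x ≠ g P := fun h' => h (hinj x hx h')
    simp [h, this]

/-- Distribution of a finite weighted family. -/
theorem exists_family {α : Type} {k : ℕ} (w : Fin (k+1) → ℝ) (c : Fin (k+1) → α)
    (hw : ∀ i, 0 ≤ w i) (h1 : ∑ i, w i = 1) :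
    ∃ ρ : FinDist α, ∀ Q, ρ.toFun Q = ∑ i, if c i = Q then w i else 0 := by
  have hsub : Function.support (fun Q => ∑ i, if c i = Q then w i else 0) ⊆
      ↑(Finset.univ.image c) := by
    intro Q hQ
    obtain ⟨i, _, hi⟩ := Finset.exists_ne_zero_of_sum_ne_zero hQ
    simp only [Finset.coe_image, Set.mem_image]
    refine ⟨i, by simp, ?_⟩
    by_contra h
    simp [h] at hi
  refine ⟨⟨fun Q => ∑ i, if c i = Q then w i else 0, ?_, ?_, ?_⟩, fun Q => rfl⟩
  · intro Q
    exact Finset.sum_nonneg fun i _ => by split_ifs <;> simp [hw]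
  · exact Set.Finite.subset (Finset.finite_toSet _) hsub
  · rw [finsum_eq_finset_sum_of_support_subset _ hsub, Finset.sum_comm, ← h1]
    apply Finset.sum_congr rfl
    intro i _
    simp

theorem expect_family {α : Type} {k : ℕ} (w : Fin (k+1) → ℝ) (c : Fin (k+1) → α)
    (ρ : FinDist α) (h : ∀ Q, ρ.toFun Q = ∑ i, if c i = Q then w i else 0) (f : α → ℝ) :
    ρ.expect f = ∑ i, w i * f (c i) := by
  rw [expect_eq _ f (Finset.univ.image c)]
  · simp only [h, Finset.sum_mul]
    rw [Finset.sum_comm]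
    apply Finset.sum_congr rfl
    intro i _
    simp [ite_mul]
  · intro x hx
    rw [h] at hx
    obtain ⟨i, _, hi⟩ := Finset.exists_ne_zero_of_sum_ne_zero hx
    by_contra hne
    apply hi
    rw [if_neg]
    rintro rfl
    simp at hne

theorem expect_one {α : Type} (μ : FinDist α) : μ.expect (fun _ => 1) = 1 := by
  unfold expect
  simp only [mul_one]
  rw [← finsum_eq_sum μ.toFun μ.finite_support]
  exact μ.sum_one

theorem expect_mix {α : Type} {μ ν ρ : FinDist α} {P : α} {c : ℝ}
    (h : ∀ Q, ν.toFun Q = μ.toFun Q + c * (ρ.toFun Q - (if Q = P then 1 else 0)))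
    (f : α → ℝ) : ν.expect f = μ.expect f + c * (ρ.expect f - f P) := by
  set s := insert P (ν.finite_support.toFinset ∪ μ.finite_support.toFinset ∪
    ρ.finite_support.toFinset) with hs
  have hP : f P = ∑ x ∈ s, (if x = P then 1 else 0) * f x := by
    simp [ite_mul, hs]
  rw [expect_eq ν f s, expect_eq μ f s, expect_eq ρ f s, hP, ← Finset.sum_sub_distrib,
    Finset.mul_sum, ← Finset.sum_add_distrib]
  · exact Finset.sum_congr rfl fun x _ => by rw [h]; ring
  all_goals
    intro x hx
    simp [hs, hx]

theorem exists_mix {α : Type} (μ ρ : FinDist α) (P : α) {p : ℝ} (hp0 : 0 ≤ p) (hp1 : p ≤ 1) :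
    ∃ ν : FinDist α, ∀ Q, ν.toFun Q =
      μ.toFun Q + μ.toFun P * p * (ρ.toFun Q - (if Q = P then 1 else 0)) := by
  set s := insert P (μ.finite_support.toFinset ∪ ρ.finite_support.toFinset) with hs
  have hsub : Function.support (fun Q => μ.toFun Q + μ.toFun P * p *
      (ρ.toFun Q - (if Q = P then 1 else 0))) ⊆ ↑s := by
    intro Q hQ
    by_contra h
    simp [hs] at h
    simp [h.1, h.2.1, h.2.2] at hQ
  refine ⟨⟨_, ?_, Set.Finite.subset (Finset.finite_toSet s) hsub, ?_⟩, fun Q => rfl⟩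
  · intro Q
    have h1 := μ.nonneg P
    have h2 := ρ.nonneg Q
    have h3 : 0 ≤ μ.toFun P * p := mul_nonneg h1 hp0
    by_cases h : Q = P
    · subst h
      have h4 := mul_nonneg h3 h2
      have h5 : μ.toFun Q * p ≤ μ.toFun Q := mul_le_of_le_one_right h1 hp1
      simp only [if_true]
      linarith
    · simp only [h, if_false, sub_zero]
      have := μ.nonneg Q
      positivity
  · rw [finsum_eq_finset_sum_of_support_subset _ hsub, Finset.sum_add_distrib,
      ← Finset.mul_sum, Finset.sum_sub_distrib]
    have e1 := expect_one μ
    have e2 := expect_one ρ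
    rw [expect_eq _ _ s (fun x hx => by simp [hs, hx])] at e1 e2
    simp only [mul_one] at e1 e2
    rw [e1, e2]
    simp [hs]

theorem mass_map {α β : Type} (g : α → β) (μ : FinDist α) (φ : Set β) (ψ : Set α)
    (h : ∀ x, μ.toFun x ≠ 0 → (g x ∈ φ ↔ x ∈ ψ)) : (μ.map g).mass φ = μ.mass ψ := by
  rw [mass_eq, mass_eq, expect_map]
  apply expect_congr
  intro x hx
  simp only [h x hx]

end FinDist

/-! ## Terms -/

theorem fromOmega_subst (a : Chan) (P : Tm) (T : Tm) : ∀ n,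
    (Tm.subst P n T).fromOmega a = Tm.subst (P.fromOmega a) n (T.fromOmega a) := by
  induction T with
  | nil => intro n; rfl
  | var m => intro n; simp only [Tm.subst, Tm.fromOmega]; split_ifs <;> rfl
  | sum k acts c ih => intro n; simp only [Tm.subst, Tm.fromOmega, ih]
  | oplus k w c ih => intro n; simp only [Tm.subst, Tm.fromOmega, ih]
  | par S T ih1 ih2 => intro n; simp only [Tm.subst, Tm.fromOmega, ih1, ih2]
  | loc L T ih => intro n; simp only [Tm.subst, Tm.fromOmega, ih]
  | fix T ih => intro n; simp only [Tm.subst, Tm.fromOmega, ih]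

theorem chans_sum_subset {k : ℕ} {acts : Fin (k+1) → Act} {c : Fin (k+1) → Tm}
    {L : Finset Chan} : (Tm.sum k acts c).chans ⊆ L ↔
      (∀ i, (acts i).chans ⊆ L) ∧ ∀ i, (c i).chans ⊆ L := by
  simp only [Tm.chans, Finset.union_subset_iff, Finset.sup_le_iff,
    Finset.mem_univ, true_imp_iff]

theorem chans_oplus_subset {k : ℕ} {w : Fin (k+1) → ℝ} {c : Fin (k+1) → Tm}
    {L : Finset Chan} : (Tm.oplus k w c).chans ⊆ L ↔ ∀ i, (c i).chans ⊆ L := by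
  simp only [Tm.chans, Finset.sup_le_iff,
    Finset.mem_univ, true_imp_iff]

theorem chans_par_subset {S T : Tm} {L : Finset Chan} :
    (Tm.par S T).chans ⊆ L ↔ S.chans ⊆ L ∧ T.chans ⊆ L := by
  simp only [Tm.chans, Finset.union_subset_iff]

theorem chans_loc_subset {M : Finset Chan} {T : Tm} {L : Finset Chan} :
    (Tm.loc M T).chans ⊆ L ↔ M ⊆ L ∧ T.chans ⊆ L := by
  simp only [Tm.chans, Finset.union_subset_iff]

theorem chans_subst {P : Tm} {L : Finset Chan} (hP : P.chans ⊆ L) (T : Tm) : ∀ n,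
    T.chans ⊆ L → (Tm.subst P n T).chans ⊆ L := by
  induction T with
  | nil => intro n h; exact h
  | var m => intro n h; simp only [Tm.subst]; split_ifs <;> assumption
  | sum k acts c ih =>
    intro n h
    rw [chans_sum_subset] at h
    simp only [Tm.subst]
    rw [chans_sum_subset]
    exact ⟨h.1, fun i => ih i n (h.2 i)⟩
  | oplus k w c ih =>
    intro n h
    rw [chans_oplus_subset] at h
    simp only [Tm.subst]
    rw [chans_oplus_subset]
    exact fun i => ih i n (h i)
  | par S T ih1 ih2 =>
    intro n h
    rw [chans_par_subset] at h
    simp only [Tm.subst]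
    rw [chans_par_subset]
    exact ⟨ih1 n h.1, ih2 n h.2⟩
  | loc L T ih =>
    intro n h
    rw [chans_loc_subset] at h
    simp only [Tm.subst]
    rw [chans_loc_subset]
    exact ⟨h.1, ih n h.2⟩
  | fix T ih => intro n h; exact ih (n+1) h

theorem act_fromOmega_inj {a : Chan} {L : Finset Chan} (ha : a ∉ L) {x y : Act}
    (hx : x.chans ⊆ L) (hy : y.chans ⊆ L) (h : x.fromOmega a = y.fromOmega a) : x = y := by
  cases x <;> cases y <;> simp_all [Act.fromOmega, Act.chans]

theorem fromOmega_inj {a : Chan} {L : Finset Chan} (ha : a ∉ L) (S : Tm) : ∀ T : Tm,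
    S.chans ⊆ L → T.chans ⊆ L → S.fromOmega a = T.fromOmega a → S = T := by
  induction S with
  | nil => intro T _ _ h; cases T <;> simp_all [Tm.fromOmega]
  | var m => intro T _ _ h; cases T <;> simp_all [Tm.fromOmega]
  | sum k acts c ih =>
    intro T hS hT h
    cases T with
    | sum k' acts' c' =>
      simp only [Tm.fromOmega, Tm.sum.injEq] at h
      obtain ⟨rfl, h1, h2⟩ := h
      rw [chans_sum_subset] at hS hT
      have e1 : acts = acts' := funext fun i =>
        act_fromOmega_inj ha (hS.1 i) (hT.1 i) (congrFun (eq_of_heq h1) i)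
      have e2 : c = c' := funext fun i =>
        ih i _ (hS.2 i) (hT.2 i) (congrFun (eq_of_heq h2) i)
      rw [e1, e2]
    | _ => simp [Tm.fromOmega] at h
  | oplus k w c ih =>
    intro T hS hT h
    cases T with
    | oplus k' w' c' =>
      simp only [Tm.fromOmega, Tm.oplus.injEq] at h
      obtain ⟨rfl, h1, h2⟩ := h
      rw [chans_oplus_subset] at hS hT
      have e2 : c = c' := funext fun i =>
        ih i _ (hS i) (hT i) (congrFun (eq_of_heq h2) i)
      rw [eq_of_heq h1, e2]
    | _ => simp [Tm.fromOmega] at h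
  | par S1 S2 ih1 ih2 =>
    intro T hS hT h
    cases T with
    | par T1 T2 =>
      simp only [Tm.fromOmega, Tm.par.injEq] at h
      rw [chans_par_subset] at hS hT
      rw [ih1 _ hS.1 hT.1 h.1, ih2 _ hS.2 hT.2 h.2]
    | _ => simp [Tm.fromOmega] at h
  | loc M S ih =>
    intro T hS hT h
    cases T with
    | loc M' T =>
      simp only [Tm.fromOmega, Tm.loc.injEq] at h
      rw [chans_loc_subset] at hS hT
      rw [h.1, ih _ hS.2 hT.2 h.2]
    | _ => simp [Tm.fromOmega] at h
  | fix S ih =>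
    intro T hS hT h
    cases T with
    | fix T =>
      simp only [Tm.fromOmega, Tm.fix.injEq] at h
      rw [ih T hS hT h]
    | _ => simp [Tm.fromOmega] at h

/-! ## Transitions -/

theorem step_chans {L : Finset Chan} {P : Tm} {α : Act} {ρ : FinDist Tm} (h : Step P α ρ) :
    P.chans ⊆ L → α.chans ⊆ L ∧ ρ.chansIn L := by
  induction h with
  | choice acts conts i =>
    intro h
    rw [chans_sum_subset] at h
    refine ⟨h.1 i, fun Q hQ => ?_⟩
    rw [FinDist.dirac_support hQ]
    exact h.2 i
  | oplus w conts ρ hw hρ =>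
    intro h
    rw [chans_oplus_subset] at h
    refine ⟨by simp [Act.chans], fun Q hQ => ?_⟩
    rw [hρ] at hQ
    obtain ⟨i, _, hi⟩ := Finset.exists_ne_zero_of_sum_ne_zero hQ
    have : conts i = Q := by
      by_contra hne
      simp [hne] at hi
    rw [← this]
    exact h i
  | parL T _ ih =>
    intro h
    rw [chans_par_subset] at h
    refine ⟨(ih h.1).1, fun Q hQ => ?_⟩
    obtain ⟨x, y, hx, hy, rfl⟩ := FinDist.parD_support hQ
    rw [chans_par_subset, FinDist.dirac_support hy]
    exact ⟨(ih h.1).2 x hx, h.2⟩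
  | parR S _ ih =>
    intro h
    rw [chans_par_subset] at h
    refine ⟨(ih h.2).1, fun Q hQ => ?_⟩
    obtain ⟨x, y, hx, hy, rfl⟩ := FinDist.parD_support hQ
    rw [chans_par_subset, FinDist.dirac_support hx]
    exact ⟨h.1, (ih h.2).2 y hy⟩
  | comm _ _ _ ih1 ih2 =>
    intro h
    rw [chans_par_subset] at h
    refine ⟨by simp [Act.chans], fun Q hQ => ?_⟩
    obtain ⟨x, y, hx, hy, rfl⟩ := FinDist.parD_support hQ
    rw [chans_par_subset]
    exact ⟨(ih1 h.1).2 x hx, (ih2 h.2).2 y hy⟩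
  | loc M _ _ ih =>
    intro h
    rw [chans_loc_subset] at h
    refine ⟨(ih h.2).1, fun Q hQ => ?_⟩
    obtain ⟨x, hx, rfl⟩ := FinDist.map_support hQ
    rw [chans_loc_subset]
    exact ⟨h.1, (ih h.2).2 x hx⟩
  | fixp _ ih =>
    intro h
    exact ih (chans_subst h _ 0 h)

theorem comp_fromOmega {a : Chan} {x y : Act} (h : Act.Comp x y) :
    Act.Comp (x.fromOmega a) (y.fromOmega a) := by
  obtain ⟨b, ⟨rfl, rfl⟩ | ⟨rfl, rfl⟩⟩ := h
  · exact ⟨b, Or.inl ⟨rfl, rfl⟩⟩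
  · exact ⟨b, Or.inr ⟨rfl, rfl⟩⟩

theorem comp_of_fromOmega {a : Chan} {L : Finset Chan} (ha : a ∉ L) {x y : Act}
    (hx : x.chans ⊆ L) (hy : y.chans ⊆ L)
    (h : Act.Comp (x.fromOmega a) (y.fromOmega a)) : Act.Comp x y := by
  obtain ⟨b, ⟨h1, h2⟩ | ⟨h1, h2⟩⟩ := h <;> refine ⟨b, ?_⟩ <;> cases x <;> cases y <;>
    simp_all [Act.fromOmega, Act.chans]

theorem step_forward {a : Chan} {L : Finset Chan} (ha : a ∉ L) {P : Tm} {α : Act}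
    {ρ : FinDist Tm} (h : Step P α ρ) :
    P.chans ⊆ L → Step (P.fromOmega a) (α.fromOmega a) (ρ.map (Tm.fromOmega a)) := by
  induction h with
  | choice acts conts i =>
    intro _
    rw [FinDist.map_dirac]
    exact Step.choice (fun i => (acts i).fromOmega a) (fun i => (conts i).fromOmega a) i
  | oplus w conts ρ hw hρ =>
    intro _
    refine Step.oplus w (fun i => (conts i).fromOmega a) _ hw ?_
    intro Q
    rw [FinDist.map_toFun, FinDist.expect_family w conts ρ hρ]
    simp
  | parL T _ ih =>
    intro h
    rw [chans_par_subset] at h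
    rw [FinDist.map_parD _ (fun _ _ => rfl), FinDist.map_dirac]
    exact Step.parL _ (ih h.1)
  | parR S _ ih =>
    intro h
    rw [chans_par_subset] at h
    rw [FinDist.map_parD _ (fun _ _ => rfl), FinDist.map_dirac]
    exact Step.parR _ (ih h.2)
  | comm hc _ _ ih1 ih2 =>
    intro h
    rw [chans_par_subset] at h
    rw [FinDist.map_parD _ (fun _ _ => rfl)]
    exact Step.comm (comp_fromOmega hc) (ih1 h.1) (ih2 h.2)
  | @loc T β ρ M _ hal ih =>
    intro h
    rw [chans_loc_subset] at h
    rw [FinDist.map_locD (Tm.fromOmega a) _ (fun _ => rfl)]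
    refine Step.loc M (ih h.2) ?_
    cases β with
    | omega => exact fun hm => ha (h.1 hm)
    | _ => exact hal
  | fixp _ ih =>
    intro h
    have := ih (chans_subst h _ 0 h)
    rw [fromOmega_subst] at this
    exact Step.fixp this

theorem step_backward {a : Chan} {L : Finset Chan} (ha : a ∉ L) {P' : Tm} {β : Act}
    {ρ' : FinDist Tm} (h : Step P' β ρ') : ∀ P : Tm, P' = P.fromOmega a →
    P.chans ⊆ L → ∃ α ρ, Step P α ρ ∧ β = α.fromOmega a ∧ ρ' = ρ.map (Tm.fromOmega a) := by
  induction h with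
  | choice acts conts i =>
    intro P hP hc
    cases P with
    | sum k' acts' conts' =>
      simp only [Tm.fromOmega, Tm.sum.injEq] at hP
      obtain ⟨rfl, h1, h2⟩ := hP
      obtain rfl := eq_of_heq h1
      obtain rfl := eq_of_heq h2
      exact ⟨_, _, Step.choice acts' conts' i, rfl, (FinDist.map_dirac _ _).symm⟩
    | _ => simp [Tm.fromOmega] at hP
  | oplus w conts ρ hw hρ =>
    intro P hP hc
    cases P with
    | oplus k' w' conts' =>
      simp only [Tm.fromOmega, Tm.oplus.injEq] at hP
      obtain ⟨rfl, h1, h2⟩ := hP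
      obtain rfl := eq_of_heq h1
      obtain rfl := eq_of_heq h2
      have e1 := FinDist.expect_one ρ
      rw [FinDist.expect_family _ _ _ hρ] at e1
      obtain ⟨σ, hσ⟩ := FinDist.exists_family w conts' (fun i => (hw i).1.le) (by simpa using e1)
      refine ⟨.tau, σ, Step.oplus w conts' σ hw hσ, rfl, ?_⟩
      apply FinDist.ext_expect
      intro f
      rw [FinDist.expect_map, FinDist.expect_family _ _ _ hρ, FinDist.expect_family _ _ _ hσ]
    | _ => simp [Tm.fromOmega] at hP
  | parL T _ ih =>
    intro P hP hc
    cases P with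
    | par S1 S2 =>
      simp only [Tm.fromOmega, Tm.par.injEq] at hP
      obtain ⟨rfl, rfl⟩ := hP
      rw [chans_par_subset] at hc
      obtain ⟨α, ρ, hs, rfl, rfl⟩ := ih S1 rfl hc.1
      exact ⟨α, _, Step.parL S2 hs, rfl, by
        rw [FinDist.map_parD _ (fun _ _ => rfl), FinDist.map_dirac]⟩
    | _ => simp [Tm.fromOmega] at hP
  | parR S _ ih =>
    intro P hP hc
    cases P with
    | par S1 S2 =>
      simp only [Tm.fromOmega, Tm.par.injEq] at hP
      obtain ⟨rfl, rfl⟩ := hP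
      rw [chans_par_subset] at hc
      obtain ⟨α, ρ, hs, rfl, rfl⟩ := ih S2 rfl hc.2
      exact ⟨α, _, Step.parR S1 hs, rfl, by
        rw [FinDist.map_parD _ (fun _ _ => rfl), FinDist.map_dirac]⟩
    | _ => simp [Tm.fromOmega] at hP
  | comm hcomp _ _ ih1 ih2 =>
    intro P hP hc
    cases P with
    | par S1 S2 =>
      simp only [Tm.fromOmega, Tm.par.injEq] at hP
      obtain ⟨rfl, rfl⟩ := hP
      rw [chans_par_subset] at hc
      obtain ⟨α1, ρ1, hs1, rfl, rfl⟩ := ih1 S1 rfl hc.1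
      obtain ⟨α2, ρ2, hs2, rfl, rfl⟩ := ih2 S2 rfl hc.2
      exact ⟨.tau, _, Step.comm (comp_of_fromOmega ha (step_chans hs1 hc.1).1
        (step_chans hs2 hc.2).1 hcomp) hs1 hs2, rfl, by
        rw [FinDist.map_parD _ (fun _ _ => rfl)]⟩
    | _ => simp [Tm.fromOmega] at hP
  | loc M _ hal ih =>
    intro P hP hc
    cases P with
    | loc M' S =>
      simp only [Tm.fromOmega, Tm.loc.injEq] at hP
      obtain ⟨rfl, rfl⟩ := hP
      rw [chans_loc_subset] at hc
      obtain ⟨α, ρ, hs, rfl, rfl⟩ := ih S rfl hc.2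
      refine ⟨α, _, Step.loc M hs ?_, rfl, by rw [FinDist.map_locD (Tm.fromOmega a) _ (fun _ => rfl)]⟩
      cases α with
      | omega => trivial
      | _ => exact hal
    | _ => simp [Tm.fromOmega] at hP
  | fixp _ ih =>
    intro P hP hc
    cases P with
    | fix S =>
      simp only [Tm.fromOmega, Tm.fix.injEq] at hP
      subst hP
      obtain ⟨α, ρ, hs, h1, h2⟩ := ih (Tm.subst (.fix S) 0 S)
        (by rw [fromOmega_subst]; rfl) (chans_subst hc _ 0 hc)
      exact ⟨α, ρ, Step.fixp hs, h1, h2⟩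
    | _ => simp [Tm.fromOmega] at hP

/-- The encoding `P ↦ (L)(P[ω↦a])`. -/
def encTm (L : Finset Chan) (a : Chan) (P : Tm) : Tm := .loc L (P.fromOmega a)

theorem locD_fromOmegaD (L : Finset Chan) (a : Chan) (μ : FinDist Tm) :
    FinDist.locD L (μ.fromOmegaD a) = μ.map (encTm L a) := by
  apply FinDist.ext_expect
  intro f
  simp only [FinDist.locD, FinDist.fromOmegaD, FinDist.expect_map, encTm]

theorem encTm_inj {a : Chan} {L : Finset Chan} (ha : a ∉ L) {S T : Tm}
    (hS : S.chans ⊆ L) (hT : T.chans ⊆ L) (h : encTm L a S = encTm L a T) : S = T := by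
  simp only [encTm, Tm.loc.injEq, true_and] at h
  exact fromOmega_inj ha S T hS hT h

theorem enc_step_tau {a : Chan} {L : Finset Chan} (ha : a ∉ L) {P : Tm}
    (hP : P.chans ⊆ L) {ρ : FinDist Tm} (h : Step P .tau ρ) :
    Step (encTm L a P) .tau (ρ.map (encTm L a)) := by
  rw [← locD_fromOmegaD]
  exact Step.loc L (step_forward ha h hP) trivial

theorem enc_step_inv {a : Chan} {L : Finset Chan} (ha : a ∉ L) {P : Tm}
    (hP : P.chans ⊆ L) {β : Act} {ρ' : FinDist Tm} (h : Step (encTm L a P) β ρ') :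
    ∃ α ρ, Step P α ρ ∧ β = α.fromOmega a ∧ Act.Allowed L β ∧ ρ' = ρ.map (encTm L a) := by
  cases h with
  | loc _ hs hal =>
    obtain ⟨α, ρ, h1, h2, rfl⟩ := step_backward ha hs P rfl hP
    exact ⟨α, ρ, h1, h2, hal, locD_fromOmegaD L a ρ⟩

theorem enc_psi {a : Chan} {L : Finset Chan} (ha : a ∉ L) {P : Tm}
    (hP : P.chans ⊆ L) : encTm L a P ∈ psiL ↔ P ∈ psiOmega := by
  constructor
  · rintro ⟨β, ρ', hβ, h⟩
    obtain ⟨α, ρ, hs, rfl, hal, _⟩ := enc_step_inv ha hP h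
    have hc := (step_chans hs hP).1
    cases α with
    | omega => exact ⟨ρ, hs⟩
    | tau => exact absurd hβ (by simp [Act.fromOmega, Act.IsLabel])
    | inp b => exact absurd (hc (by simp [Act.chans])) hal
    | out b => exact absurd (hc (by simp [Act.chans])) hal
  · rintro ⟨ρ, hs⟩
    exact ⟨.inp a, _, trivial, Step.loc L (step_forward ha hs hP) ha⟩

theorem pstep_chans {L : Finset Chan} {μ ν : FinDist Tm} (hμ : μ.chansIn L) {α : Act} {p : ℝ}
    (h : PStep μ α p ν) : ν.chansIn L := by
  obtain ⟨_, _, P, ρ, hP, hs, hν⟩ := h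
  have hPL := hμ P hP.ne'
  intro Q hQ
  by_cases h1 : Q = P
  · rw [h1]; exact hPL
  by_cases h2 : μ.toFun Q = 0
  · apply (step_chans hs hPL).2 Q
    intro h3
    apply hQ
    rw [hν, h2, h3]
    simp [h1]
  · exact hμ Q h2

theorem enc_toFun {a : Chan} {L : Finset Chan} (ha : a ∉ L) {μ : FinDist Tm}
    (hμ : μ.chansIn L) {P : Tm} (hP : P.chans ⊆ L) :
    (μ.map (encTm L a)).toFun (encTm L a P) = μ.toFun P :=
  FinDist.map_toFun_inj _ _ _ fun x hx h => encTm_inj ha (hμ x hx) hP h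

theorem map_mix {g : Tm → Tm} {μ ν ρ : FinDist Tm} {P : Tm} {c : ℝ}
    (h : ∀ Q, ν.toFun Q = μ.toFun Q + c * (ρ.toFun Q - (if Q = P then 1 else 0))) (Q : Tm) :
    (ν.map g).toFun Q = (μ.map g).toFun Q + c * ((ρ.map g).toFun Q -
      (if Q = g P then 1 else 0)) := by
  simp only [FinDist.map_toFun]
  rw [FinDist.expect_mix h]
  simp only [eq_comm]

theorem enc_pstep {a : Chan} {L : Finset Chan} (ha : a ∉ L) {μ ν : FinDist Tm}
    (hμ : μ.chansIn L) {p : ℝ} (h : PStep μ .tau p ν) :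
    PStep (μ.map (encTm L a)) .tau p (ν.map (encTm L a)) := by
  obtain ⟨h0, h1, P, ρ, hP, hs, hν⟩ := h
  have hPL := hμ P hP.ne'
  refine ⟨h0, h1, encTm L a P, ρ.map (encTm L a), ?_, enc_step_tau ha hPL hs, ?_⟩
  · rwa [enc_toFun ha hμ hPL]
  · rw [enc_toFun ha hμ hPL]
    exact map_mix hν

theorem enc_pstep_inv {a : Chan} {L : Finset Chan} (ha : a ∉ L) {μ ν' : FinDist Tm}
    (hμ : μ.chansIn L) {p : ℝ} (h : PStep (μ.map (encTm L a)) .tau p ν') :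
    ∃ ν, PStep μ .tau p ν ∧ ν' = ν.map (encTm L a) := by
  obtain ⟨h0, h1, P', ρ', hP, hs, hν⟩ := h
  obtain ⟨P, hP0, rfl⟩ := FinDist.map_support hP.ne'
  have hPL := hμ P hP0
  rw [enc_toFun ha hμ hPL] at hP hν
  obtain ⟨α, ρ, hs', hα, _, rfl⟩ := enc_step_inv ha hPL hs
  have : α = .tau := by
    clear hs hs' hν
    cases α <;> simp [Act.fromOmega] at hα ⊢
  subst this
  obtain ⟨ν, hν2⟩ := FinDist.exists_mix μ ρ P h0.le h1
  refine ⟨ν, ⟨h0, h1, P, ρ, hP, hs', hν2⟩, ?_⟩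
  apply FinDist.ext_toFun
  intro Q
  rw [hν, map_mix hν2]

theorem pseq_chans {L : Finset Chan} (π : List (Act × ℝ)) : ∀ {μ ν : FinDist Tm},
    μ.chansIn L → PSeq μ π ν → ν.chansIn L := by
  induction π with
  | nil => rintro μ ν hμ rfl; exact hμ
  | cons s π ih =>
    rintro μ ν hμ ⟨μ', h1, h2⟩
    exact ih (pstep_chans hμ h1) h2

theorem enc_pseq {a : Chan} {L : Finset Chan} (ha : a ∉ L) (π : List (Act × ℝ)) :
    ∀ {μ ν : FinDist Tm}, (∀ s ∈ π, s.1 = Act.tau) → μ.chansIn L → PSeq μ π ν →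
      PSeq (μ.map (encTm L a)) π (ν.map (encTm L a)) := by
  induction π with
  | nil => rintro μ ν _ _ rfl; rfl
  | cons s π ih =>
    rintro μ ν hπ hμ ⟨μ', h1, h2⟩
    have hs : s.1 = Act.tau := hπ s (by simp)
    refine ⟨_, ?_, ih (fun t ht => hπ t (by simp [ht])) (pstep_chans hμ h1) h2⟩
    rw [hs] at h1 ⊢
    exact enc_pstep ha hμ h1

theorem enc_pseq_inv {a : Chan} {L : Finset Chan} (ha : a ∉ L) (π : List (Act × ℝ)) :
    ∀ {μ ν' : FinDist Tm}, (∀ s ∈ π, s.1 = Act.tau) → μ.chansIn L →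
      PSeq (μ.map (encTm L a)) π ν' → ∃ ν, PSeq μ π ν ∧ ν' = ν.map (encTm L a) := by
  induction π with
  | nil => rintro μ ν' _ _ rfl; exact ⟨μ, rfl, rfl⟩
  | cons s π ih =>
    rintro μ ν' hπ hμ ⟨μ', h1, h2⟩
    have hs : s.1 = Act.tau := hπ s (by simp)
    rw [hs] at h1
    obtain ⟨μ1, h3, rfl⟩ := enc_pstep_inv ha hμ h1
    obtain ⟨ν, h4, h5⟩ := ih (fun t ht => hπ t (by simp [ht])) (pstep_chans hμ h3) h2
    exact ⟨ν, ⟨μ1, by rw [hs]; exact h3, h4⟩, h5⟩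

theorem internal_chans {L : Finset Chan} {μ ν : FinDist Tm} (hμ : μ.chansIn L)
    (h : Internal μ ν) : ν.chansIn L := by
  obtain ⟨π, _, h⟩ := h
  exact pseq_chans π hμ h

theorem enc_internal {a : Chan} {L : Finset Chan} (ha : a ∉ L) {μ : FinDist Tm}
    (hμ : μ.chansIn L) (ν' : FinDist Tm) :
    Internal (μ.map (encTm L a)) ν' ↔ ∃ ν, Internal μ ν ∧ ν' = ν.map (encTm L a) := by
  constructor
  · rintro ⟨π, hπ, h⟩
    obtain ⟨ν, h1, h2⟩ := enc_pseq_inv ha π hπ hμ h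
    exact ⟨ν, ⟨π, hπ, h1⟩, h2⟩
  · rintro ⟨ν, ⟨π, hπ, h⟩, rfl⟩
    exact ⟨π, hπ, enc_pseq ha π hπ hμ h⟩

theorem enc_chiMay {a : Chan} {L : Finset Chan} (ha : a ∉ L) {μ : FinDist Tm}
    (hμ : μ.chansIn L) : chiMayOmega μ = chiMayL (μ.map (encTm L a)) := by
  unfold chiMayOmega chiMayL
  congr 1
  have key : ∀ ν, Internal μ ν → (ν.map (encTm L a)).mass psiL = ν.mass psiOmega :=
    fun ν hν => FinDist.mass_map _ _ _ _ fun x hx => enc_psi ha (internal_chans hμ hν x hx)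
  ext x
  constructor
  · rintro ⟨ν, hν, rfl⟩
    exact ⟨_, (enc_internal ha hμ _).2 ⟨ν, hν, rfl⟩, (key ν hν).symm⟩
  · rintro ⟨ν', hν', rfl⟩
    obtain ⟨ν, hν, rfl⟩ := (enc_internal ha hμ _).1 hν'
    exact ⟨ν, hν, key ν hν⟩

theorem enc_chiFair {a : Chan} {L : Finset Chan} (ha : a ∉ L) {μ : FinDist Tm}
    (hμ : μ.chansIn L) : chiFairOmega μ = chiFairL (μ.map (encTm L a)) := by
  unfold chiFairOmega chiFairL
  congr 1
  ext x
  constructor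
  · rintro ⟨ν, hν, rfl⟩
    exact ⟨_, (enc_internal ha hμ _).2 ⟨ν, hν, rfl⟩, enc_chiMay ha (internal_chans hμ hν)⟩
  · rintro ⟨ν', hν', rfl⟩
    obtain ⟨ν, hν, rfl⟩ := (enc_internal ha hμ _).1 hν'
    exact ⟨ν, hν, (enc_chiMay ha (internal_chans hμ hν)).symm⟩

/-- For a distribution `μ` over RCCS^ω processes whose channels
lie in the finite set `L`, and a fresh channel `a ∉ L`:
`χmay_ω(μ) = χmay_𝓛((L)(μ[ω↦a]))` and `χfair_ω(μ) = χfair_𝓛((L)(μ[ω↦a]))`. -/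
theorem omega_characteristics_via_renaming
    (μ : FinDist Tm) (hclosed : ∀ P, μ.toFun P ≠ 0 → Tm.ClosedAt 0 P)
    (L : Finset Chan) (hL : μ.chansIn L) (a : Chan) (ha : a ∉ L) :
    chiMayOmega μ = chiMayL (FinDist.locD L (μ.fromOmegaD a)) ∧
    chiFairOmega μ = chiFairL (FinDist.locD L (μ.fromOmegaD a)) := by
  rw [locD_fromOmegaD]
  exact ⟨enc_chiMay ha hL, enc_chiFair ha hL⟩
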